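/- Let l₁, l₂, l₃, l₄ be four distinct lines in Pic S₈ that pairwise intersect in 1 and form a cornered A₃⁸(1)-polytope. Then for every labeling {i,j,k,m} = {1,2,3,4}, the four classes lᵢ, lⱼ, B(l_k), B(l_m) (where B is the Bertini transform) are distinct lines pairwise intersecting in 1, and they form a cornered A₃⁸(1)-polytope. -/

import Mathlib

/-!
Picard lattice of the degree 1 del Pezzo surface S₈:
Pic S₈ = ℤh ⊕ ℤe₁ ⊕ ⋯ ⊕ ℤe₈ ≅ ℤ⁹, with intersection pairing
h·h = 1, h·eᵢ = 0, eᵢ·eⱼ = −δᵢⱼ, and canonical class K = −3h + e₁ + ⋯ + e₈.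
-/

namespace DelPezzo

/-- The Picard lattice `Pic S₈ ≅ ℤ⁹`; coordinate `0` is the `h`-coordinate and
coordinates `1,…,8` are the `e₁,…,e₈`-coordinates. -/
abbrev Pic : Type := Fin 9 → ℤ

/-- The intersection pairing on `Pic S₈` (signature `(1,-8)`). -/
def inter (x y : Pic) : ℤ := x 0 * y 0 - ∑ i : Fin 8, x i.succ * y i.succ

/-- The canonical class `K = -3h + e₁ + ⋯ + e₈`. -/
def K : Pic := fun i => if i = 0 then -3 else 1

/-- A line: a class `l` with `l·l = -1` and `l·K = -1`. -/
def IsLine (l : Pic) : Prop := inter l l = -1 ∧ inter l K = -1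

/-- The Bertini transform of a line. -/
def B (l : Pic) : Pic := -(2 • K) - l

theorem inter_comm (x y : Pic) : inter x y = inter y x := by
  simp [inter, mul_comm]

theorem inter_add_left (x y z : Pic) : inter (x + y) z = inter x z + inter y z := by
  simp only [inter, Pi.add_apply, add_mul, Finset.sum_add_distrib]
  ring

theorem inter_smul_left (c : ℤ) (x z : Pic) : inter (c • x) z = c * inter x z := by
  simp only [inter, Pi.smul_apply, smul_eq_mul, mul_assoc, mul_sub, Finset.mul_sum]

theorem inter_neg_left (x z : Pic) : inter (-x) z = -inter x z := by
  simpa using inter_smul_left (-1) x z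

theorem inter_sub_left (x y z : Pic) : inter (x - y) z = inter x z - inter y z := by
  rw [sub_eq_add_neg, inter_add_left, inter_neg_left, sub_eq_add_neg]

theorem inter_sub_right (x y z : Pic) : inter x (y - z) = inter x y - inter x z := by
  rw [inter_comm, inter_sub_left, inter_comm y, inter_comm z]

theorem inter_K_K : inter K K = 1 := by decide

theorem inter_B_left (x y : Pic) : inter (B x) y = -2 * inter y K - inter x y := by
  rw [B, inter_sub_left, inter_neg_left, two_nsmul, inter_add_left, inter_comm K y]
  ring

theorem inter_B_right (x y : Pic) : inter x (B y) = -2 * inter x K - inter x y := by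
  rw [inter_comm, inter_B_left, inter_comm y x]

theorem IsLine.bertini {l : Pic} (hl : IsLine l) : IsLine (B l) := by
  obtain ⟨h₁, h₂⟩ := hl
  constructor <;> simp [inter_B_left, inter_B_right, inter_K_K, h₁, h₂]

/-- The line orthogonal to two lines `a`, `b` and to `B p`, `B q`, given a line `c` orthogonal to
`a`, `b`, `p`, `q`, is the class `B p - q + c`. -/
theorem isLine_bertini_sub_add {c p q : Pic} (hc : IsLine c) (hp : IsLine p) (hq : IsLine q)
    (hpq : inter p q = 1) (hcp : inter c p = 0) (hcq : inter c q = 0) :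
    IsLine (B p - (q - c)) := by
  obtain ⟨hc₁, hc₂⟩ := hc
  obtain ⟨hp₁, hp₂⟩ := hp
  obtain ⟨hq₁, hq₂⟩ := hq
  have hqp := inter_comm q p
  have hpc := inter_comm p c
  have hqc := inter_comm q c
  constructor <;>
    simp only [inter_B_left, inter_B_right, inter_sub_left, inter_sub_right, inter_K_K] <;>
    linarith

/-- Classes of self-intersection `-1` that pairwise intersect in `1` are distinct. -/
theorem injective_of_inter_eq_one {ι : Type*} {f : ι → Pic} (hf : ∀ a, IsLine (f a))
    (h : ∀ a b, a ≠ b → inter (f a) (f b) = 1) : Function.Injective f := by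
  intro a b hab
  by_contra hne
  have h₁ := h a b hne
  rw [← hab, (hf a).1] at h₁
  norm_num at h₁

theorem pairwise_ne_of_eq_univ : ∀ i j k m : Fin 4,
    ({i, j, k, m} : Finset (Fin 4)) = Finset.univ →
      i ≠ j ∧ i ≠ k ∧ i ≠ m ∧ j ≠ k ∧ j ≠ m ∧ k ≠ m := by
  decide

theorem bertini_pairs_give_cornered_simplex (l : Fin 4 → Pic)
    (hinj : Function.Injective l)
    (hline : ∀ i, IsLine (l i))
    (hint : ∀ i j, i ≠ j → inter (l i) (l j) = 1)
    (hcor : ∃ m : Pic, IsLine m ∧ ∀ i, inter m (l i) = 0)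
    (i j k m : Fin 4) (hall : ({i, j, k, m} : Finset (Fin 4)) = Finset.univ) :
    Function.Injective ![l i, l j, B (l k), B (l m)] ∧
    (∀ a, IsLine (![l i, l j, B (l k), B (l m)] a)) ∧
    (∀ a b, a ≠ b →
      inter (![l i, l j, B (l k), B (l m)] a) (![l i, l j, B (l k), B (l m)] b) = 1) ∧
    (∃ n : Pic, IsLine n ∧ ∀ a, inter n (![l i, l j, B (l k), B (l m)] a) = 0) := by
  obtain ⟨hij, hik, him, hjk, hjm, hkm⟩ := pairwise_ne_of_eq_univ i j k m hall
  obtain ⟨c, hc, hcl⟩ := hcor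
  have hL : ∀ a, IsLine (![l i, l j, B (l k), B (l m)] a) := by
    intro a
    fin_cases a
    exacts [hline i, hline j, (hline k).bertini, (hline m).bertini]
  have hI : ∀ a b, a ≠ b →
      inter (![l i, l j, B (l k), B (l m)] a) (![l i, l j, B (l k), B (l m)] b) = 1 := by
    intro a b hab
    fin_cases a <;> fin_cases b <;>
      simp [inter_B_left, inter_B_right, inter_K_K, (hline _).2, hint, hij, hik, him, hjk, hjm,
        hkm, hij.symm, hik.symm, him.symm, hjk.symm, hjm.symm, hkm.symm] at hab ⊢
  refine ⟨injective_of_inter_eq_one hL hI, hL, hI, B (l k) - (l m - c),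
    isLine_bertini_sub_add hc (hline k) (hline m) (hint k m hkm) (hcl k) (hcl m), ?_⟩
  intro a
  fin_cases a <;>
    simp [inter_sub_left, inter_B_left, inter_B_right, inter_K_K, (hline _).1, (hline _).2, hc.2,
      hcl, hint, hkm, hkm.symm, hik.symm, him.symm, hjk.symm, hjm.symm]

end DelPezzo
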